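/- arXiv:2410.04136 — 2 statements merged into one kernel-verified Lean document; each statement's English description precedes it below -/
import Mathlib

section
/- Let (c_1,…,c_k) be a P-admissible finite tuple and x_0 = Inf^P(c_1…c_k). For each n ≥ 1 let d^{(n)} be a P-admissible sequence with x_n = val_P(d^{(n)}) satisfying x_0 < x_n ≤ 1. Then x_n → x_0 if and only if there exists n_0 such that: (i) for all n ≥ n_0 and all i ≤ k one has d^{(n)}_i = c_i, and (ii) d^{(n)}_{k+1} → ∞ as n → ∞. -/
open Filter Finset Topology

/-! `φ` encodes the family of functions: `φ []` is `φ₀` and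
`φ [c₁, …, cₙ]` is `φₙ(c₁, …, cₙ)`. Sequences are 0-indexed:
`p 0` is the paper's `p₁`. -/

/-- The list of the first `n` terms of the sequence `p`. -/
def prefixList (p : ℕ → ℕ) (n : ℕ) : List ℕ :=
  List.ofFn (fun i : Fin n => p i)

/-- A sequence `p` is `P`-admissible if `pₙ ≥ r_{n-1} + 1` for all `n ≥ 1`. -/
def PAdmissibleSeq (φ : List ℕ → ℕ) (p : ℕ → ℕ) : Prop :=
  ∀ n : ℕ, φ (prefixList p n) + 1 ≤ p n

/-- A tuple `(c₁, …, c_k)` (given as the first `k` values of `c`) is `P`-admissible. -/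
def PAdmissibleTuple (φ : List ℕ → ℕ) (c : ℕ → ℕ) (k : ℕ) : Prop :=
  ∀ n < k, φ (prefixList c n) + 1 ≤ c n

/-- `r₀ r₁ ⋯ rₙ` where `rᵢ = φᵢ(p₁, …, pᵢ)`. -/
noncomputable def numer (φ : List ℕ → ℕ) (p : ℕ → ℕ) (n : ℕ) : ℝ :=
  ∏ i ∈ Finset.range (n + 1), (φ (prefixList p i) : ℝ)

/-- `(p₁ − 1)p₁ ⋯ (pₙ − 1)pₙ`. -/
noncomputable def denomBase (p : ℕ → ℕ) (n : ℕ) : ℝ :=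
  ∏ j ∈ Finset.range n, (((p j : ℝ) - 1) * (p j : ℝ))

/-- The `P`-value `val_P(p) = Σ_{n=0}^∞ (r₀⋯rₙ)/((p₁−1)p₁⋯(pₙ−1)pₙ·p_{n+1})`. -/
noncomputable def valP (φ : List ℕ → ℕ) (p : ℕ → ℕ) : ℝ :=
  ∑' n : ℕ, numer φ p n / (denomBase p n * (p n : ℝ))

/-- The `P⁻`-value
`val_{P⁻}(q) = Σ_{n=0}^∞ (−1)ⁿ (r₀⋯rₙ)/((q₁−1)q₁⋯(qₙ−1)qₙ·(q_{n+1}−1))`. -/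
noncomputable def valPNeg (φ : List ℕ → ℕ) (q : ℕ → ℕ) : ℝ :=
  ∑' n : ℕ, (-1 : ℝ) ^ n * numer φ q n / (denomBase q n * ((q n : ℝ) - 1))

/-- `Inf^P(c₁…c_k) = Σ_{n=0}^{k−1} (r₀⋯rₙ)/((c₁−1)c₁⋯(cₙ−1)cₙ·c_{n+1})`. -/
noncomputable def InfP (φ : List ℕ → ℕ) (c : ℕ → ℕ) (k : ℕ) : ℝ :=
  ∑ n ∈ Finset.range k, numer φ c n / (denomBase c n * (c n : ℝ))

/-- The diameter `(r₀⋯r_{k−1})/((c₁−1)c₁⋯(c_k−1)c_k)`. -/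
noncomputable def DiamP (φ : List ℕ → ℕ) (c : ℕ → ℕ) (k : ℕ) : ℝ :=
  (∏ i ∈ Finset.range k, (φ (prefixList c i) : ℝ)) / denomBase c k

/-- `Sup^P(c₁…c_k) = Inf^P(c₁…c_k) + (r₀⋯r_{k−1})/((c₁−1)c₁⋯(c_k−1)c_k)`. -/
noncomputable def SupP (φ : List ℕ → ℕ) (c : ℕ → ℕ) (k : ℕ) : ℝ :=
  InfP φ c k + DiamP φ c k

/-- `A(c₁…c_k) = Σ_{n=0}^{k−1} (−1)ⁿ (r₀⋯rₙ)/((c₁−1)c₁⋯(cₙ−1)cₙ·(c_{n+1}−1))`. -/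
noncomputable def APNeg (φ : List ℕ → ℕ) (c : ℕ → ℕ) (k : ℕ) : ℝ :=
  ∑ n ∈ Finset.range k, (-1 : ℝ) ^ n * numer φ c n / (denomBase c n * ((c n : ℝ) - 1))

/-- `Sup^{P⁻}(c₁…c_k)`: `A` if `k` odd, `A + D` if `k` even. -/
noncomputable def SupPNeg (φ : List ℕ → ℕ) (c : ℕ → ℕ) (k : ℕ) : ℝ :=
  if Odd k then APNeg φ c k else APNeg φ c k + DiamP φ c k

/-- `Inf^{P⁻}(c₁…c_k)`: `A − D` if `k` odd, `A` if `k` even. -/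
noncomputable def InfPNeg (φ : List ℕ → ℕ) (c : ℕ → ℕ) (k : ℕ) : ℝ :=
  if Odd k then APNeg φ c k - DiamP φ c k else APNeg φ c k
theorem prefixList_congr {p q : ℕ → ℕ} {n : ℕ} (h : ∀ i < n, p i = q i) :
    prefixList p n = prefixList q n := by
  unfold prefixList
  congr 1
  funext i
  exact h i i.2

theorem InfP_succ (φ : List ℕ → ℕ) (p : ℕ → ℕ) (n : ℕ) :
    InfP φ p (n + 1) = InfP φ p n + DiamP φ p n * (φ (prefixList p n) / p n) := by
  rw [InfP, InfP, sum_range_succ, DiamP, numer, prod_range_succ, div_mul_div_comm]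

theorem DiamP_succ (φ : List ℕ → ℕ) (p : ℕ → ℕ) (n : ℕ) :
    DiamP φ p (n + 1) =
      DiamP φ p n * (φ (prefixList p n) / (((p n : ℝ) - 1) * p n)) := by
  rw [DiamP, DiamP, denomBase, denomBase, prod_range_succ, prod_range_succ, div_mul_div_comm]

theorem DiamP_congr (φ : List ℕ → ℕ) {p q : ℕ → ℕ} {n : ℕ} (h : ∀ i < n, p i = q i) :
    DiamP φ p n = DiamP φ q n := by
  induction n with
  | zero => simp [DiamP, denomBase]
  | succ n ih =>
    rw [DiamP_succ, DiamP_succ, ih fun i hi => h i (by omega),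
      prefixList_congr fun i hi => h i (Nat.lt_succ_of_lt hi), h n (Nat.lt_succ_self n)]

theorem InfP_congr (φ : List ℕ → ℕ) {p q : ℕ → ℕ} {n : ℕ} (h : ∀ i < n, p i = q i) :
    InfP φ p n = InfP φ q n := by
  induction n with
  | zero => simp [InfP]
  | succ n ih =>
    have h' : ∀ i < n, p i = q i := fun i hi => h i (Nat.lt_succ_of_lt hi)
    rw [InfP_succ, InfP_succ, ih h', DiamP_congr φ h', prefixList_congr h',
      h n (Nat.lt_succ_self n)]

/-- The upper endpoint of the next cylinder, as a function of the new last term. -/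
theorem SupP_succ (φ : List ℕ → ℕ) (p : ℕ → ℕ) (n : ℕ) (hp : 2 ≤ p n) :
    SupP φ p (n + 1) = InfP φ p n + DiamP φ p n * (φ (prefixList p n) / ((p n : ℝ) - 1)) := by
  have h2 : (2 : ℝ) ≤ p n := by exact_mod_cast hp
  have h0 : (p n : ℝ) ≠ 0 := by linarith
  have h1 : (p n : ℝ) - 1 ≠ 0 := by linarith
  rw [SupP, InfP_succ, DiamP_succ]
  field_simp
  ring

section

variable {φ : List ℕ → ℕ} {p : ℕ → ℕ} {k : ℕ}

theorem PAdmissibleSeq.tuple (hp : PAdmissibleSeq φ p) (k : ℕ) : PAdmissibleTuple φ p k :=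
  fun n _ => hp n

theorem PAdmissibleTuple.two_le (hφ : ∀ l, 0 < φ l) (hp : PAdmissibleTuple φ p k) {n : ℕ}
    (hn : n < k) : 2 ≤ p n := by
  have := hp n hn
  have := hφ (prefixList p n)
  omega

theorem DiamP_pos (hφ : ∀ l, 0 < φ l) (hp : PAdmissibleTuple φ p k) {n : ℕ} (hn : n ≤ k) :
    0 < DiamP φ p n := by
  refine div_pos (prod_pos fun i _ => by exact_mod_cast hφ _) (prod_pos fun i hi => ?_)
  have h2 : (2 : ℝ) ≤ p i := by
    exact_mod_cast hp.two_le hφ (lt_of_lt_of_le (mem_range.1 hi) hn)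
  exact mul_pos (by linarith) (by linarith)

theorem InfP_lt_succ (hφ : ∀ l, 0 < φ l) (hp : PAdmissibleTuple φ p k) {n : ℕ} (hn : n < k) :
    InfP φ p n < InfP φ p (n + 1) := by
  have hD := DiamP_pos hφ hp hn.le
  have hr : (0 : ℝ) < φ (prefixList p n) := by exact_mod_cast hφ _
  have h2 : (0 : ℝ) < p n := by exact_mod_cast (by have := hp.two_le hφ hn; omega : 0 < p n)
  rw [InfP_succ]
  exact lt_add_of_pos_right _ (by positivity)

theorem SupP_succ_le (hφ : ∀ l, 0 < φ l) (hp : PAdmissibleTuple φ p k) {n : ℕ} (hn : n < k) :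
    SupP φ p (n + 1) ≤ SupP φ p n := by
  have h2 := hp.two_le hφ hn
  rw [SupP_succ φ p n h2, SupP]
  have h2' : (2 : ℝ) ≤ p n := by exact_mod_cast h2
  have h : (φ (prefixList p n) : ℝ) + 1 ≤ p n := by exact_mod_cast hp n hn
  gcongr
  refine mul_le_of_le_one_right (DiamP_pos hφ hp hn.le).le ?_
  rw [div_le_one (by linarith)]
  linarith

theorem InfP_mono (hφ : ∀ l, 0 < φ l) (hp : PAdmissibleTuple φ p k) {m n : ℕ} (hmn : m ≤ n)
    (hn : n ≤ k) : InfP φ p m ≤ InfP φ p n := by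
  induction n, hmn using Nat.le_induction with
  | base => exact le_rfl
  | succ n _ ih => exact (ih (by omega)).trans (InfP_lt_succ hφ hp hn).le

theorem SupP_anti (hφ : ∀ l, 0 < φ l) (hp : PAdmissibleTuple φ p k) {m n : ℕ} (hmn : m ≤ n)
    (hn : n ≤ k) : SupP φ p n ≤ SupP φ p m := by
  induction n, hmn using Nat.le_induction with
  | base => exact le_rfl
  | succ n _ ih => exact (SupP_succ_le hφ hp hn).trans (ih (by omega))

theorem InfP_le_SupP (hφ : ∀ l, 0 < φ l) (hp : PAdmissibleSeq φ p) (m n : ℕ) :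
    InfP φ p m ≤ SupP φ p n := by
  have ht := hp.tuple (max m n)
  calc InfP φ p m ≤ InfP φ p (max m n) := InfP_mono hφ ht (le_max_left _ _) le_rfl
    _ ≤ SupP φ p (max m n) := le_add_of_nonneg_right (DiamP_pos hφ ht le_rfl).le
    _ ≤ SupP φ p n := SupP_anti hφ ht (le_max_right _ _) le_rfl

theorem tendsto_InfP_valP (hφ : ∀ l, 0 < φ l) (hp : PAdmissibleSeq φ p) :
    Tendsto (InfP φ p) atTop (𝓝 (valP φ p)) := by
  refine (summable_of_sum_range_le (c := SupP φ p 0) (fun n => ?_)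
    fun n => InfP_le_SupP hφ hp n 0).hasSum.tendsto_sum_nat
  have h := InfP_lt_succ hφ (hp.tuple (n + 1)) (Nat.lt_succ_self n)
  rw [InfP, InfP, sum_range_succ] at h
  linarith

theorem InfP_lt_valP (hφ : ∀ l, 0 < φ l) (hp : PAdmissibleSeq φ p) (n : ℕ) :
    InfP φ p n < valP φ p := by
  refine (InfP_lt_succ hφ (hp.tuple (n + 1)) (Nat.lt_succ_self n)).trans_le ?_
  refine ge_of_tendsto (tendsto_InfP_valP hφ hp) ?_
  filter_upwards [eventually_ge_atTop (n + 1)] with m hm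
  exact InfP_mono hφ (hp.tuple m) hm le_rfl

theorem valP_le_SupP (hφ : ∀ l, 0 < φ l) (hp : PAdmissibleSeq φ p) (n : ℕ) :
    valP φ p ≤ SupP φ p n :=
  le_of_tendsto' (tendsto_InfP_valP hφ hp) fun m => InfP_le_SupP hφ hp m n

/-- A value above the infimum of a cylinder and below its supremum belongs to the cylinder. -/
theorem eq_of_InfP_lt_valP_lt_SupP (hφ : ∀ l, 0 < φ l) {c d : ℕ → ℕ}
    (hc : PAdmissibleTuple φ c k) (hd : PAdmissibleSeq φ d) (h1 : InfP φ c k < valP φ d)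
    (h2 : valP φ d < SupP φ c k) : ∀ i < k, d i = c i := by
  intro i
  induction i using Nat.strong_induction_on with
  | _ i ih =>
    intro hi
    have hpre : ∀ j < i, d j = c j := fun j hj => ih j hj (hj.trans hi)
    have hD : 0 < DiamP φ c i := DiamP_pos hφ hc hi.le
    have hc2 := hc.two_le hφ hi
    have hd2 := (hd.tuple (i + 1)).two_le hφ (Nat.lt_succ_self i)
    have hc2' : (2 : ℝ) ≤ c i := by exact_mod_cast hc2
    have hd2' : (2 : ℝ) ≤ d i := by exact_mod_cast hd2
    rcases lt_trichotomy (d i) (c i) with hlt | heq | hgt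
    · exfalso
      have hlt' : (d i : ℝ) + 1 ≤ c i := by exact_mod_cast hlt
      refine absurd h2 (not_lt.2 ?_)
      calc SupP φ c k ≤ SupP φ c (i + 1) := SupP_anti hφ hc hi le_rfl
        _ = InfP φ c i + DiamP φ c i * (φ (prefixList c i) / ((c i : ℝ) - 1)) :=
          SupP_succ φ c i hc2
        _ ≤ InfP φ c i + DiamP φ c i * (φ (prefixList c i) / (d i : ℝ)) := by
          gcongr
          linarith
        _ = InfP φ d (i + 1) := by
          rw [InfP_succ, InfP_congr φ hpre, DiamP_congr φ hpre, prefixList_congr hpre]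
        _ ≤ valP φ d := (InfP_lt_valP hφ hd _).le
    · exact heq
    · exfalso
      have hgt' : (c i : ℝ) + 1 ≤ d i := by exact_mod_cast hgt
      refine absurd h1 (not_lt.2 ?_)
      calc valP φ d ≤ SupP φ d (i + 1) := valP_le_SupP hφ hd _
        _ = InfP φ c i + DiamP φ c i * (φ (prefixList c i) / ((d i : ℝ) - 1)) := by
          rw [SupP_succ φ d i hd2, InfP_congr φ hpre, DiamP_congr φ hpre, prefixList_congr hpre]
        _ ≤ InfP φ c i + DiamP φ c i * (φ (prefixList c i) / (c i : ℝ)) := by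
          gcongr
          linarith
        _ = InfP φ c (i + 1) := (InfP_succ φ c i).symm
        _ ≤ InfP φ c k := InfP_mono hφ hc hi le_rfl

end

/-- convergence from the right to `x₀ = Inf^P(c₁…c_k)`. -/
theorem stmt3 (φ : List ℕ → ℕ) (hφ : ∀ l, 0 < φ l)
    (k : ℕ) (hk : 0 < k)
    (c : ℕ → ℕ) (hc : PAdmissibleTuple φ c k)
    (d : ℕ → (ℕ → ℕ)) (hd : ∀ n, PAdmissibleSeq φ (d n))
    (hx : ∀ n, InfP φ c k < valP φ (d n) ∧ valP φ (d n) ≤ 1) :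
    Filter.Tendsto (fun n => valP φ (d n)) Filter.atTop (nhds (InfP φ c k)) ↔
      ∃ n0 : ℕ, (∀ n ≥ n0, ∀ i < k, d n i = c i) ∧
        Filter.Tendsto (fun n => d n k) Filter.atTop Filter.atTop := by
  have hD : 0 < DiamP φ c k := DiamP_pos hφ hc le_rfl
  have hr : (0 : ℝ) < φ (prefixList c k) := by exact_mod_cast hφ _
  constructor
  · intro h
    have hev : ∀ᶠ n in atTop, ∀ i < k, d n i = c i := by
      filter_upwards [h.eventually_lt_const (lt_add_of_pos_right _ hD)] with n hn
      exact eq_of_InfP_lt_valP_lt_SupP hφ hc (hd n) (hx n).1 hn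
    obtain ⟨n0, hn0⟩ := eventually_atTop.1 hev
    refine ⟨n0, hn0, tendsto_atTop.2 fun M => ?_⟩
    have hgap : 0 < DiamP φ c k * (φ (prefixList c k) / ((M : ℝ) + 1)) := by positivity
    filter_upwards [hev, h.eventually_lt_const (lt_add_of_pos_right _ hgap)] with n hn hlt
    have hlow := InfP_lt_valP hφ (hd n) (k + 1)
    rw [InfP_succ, InfP_congr φ hn, DiamP_congr φ hn, prefixList_congr hn] at hlow
    by_contra! hM
    have hM' : (d n k : ℝ) ≤ M + 1 := by exact_mod_cast (by omega : d n k ≤ M + 1)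
    have hpos : (0 : ℝ) < d n k := by
      exact_mod_cast (Nat.succ_pos _).trans_le (hd n k)
    have : DiamP φ c k * (φ (prefixList c k) / ((M : ℝ) + 1)) ≤
        DiamP φ c k * (φ (prefixList c k) / (d n k : ℝ)) := by
      gcongr
    linarith
  · rintro ⟨n0, hn0, hlim⟩
    have hlim' : Tendsto (fun n => (d n k : ℝ) - 1) atTop atTop :=
      tendsto_atTop_add_const_right _ _ (tendsto_natCast_atTop_atTop.comp hlim)
    have hup : Tendsto (fun n => InfP φ c k +
        DiamP φ c k * (φ (prefixList c k) / ((d n k : ℝ) - 1))) atTop (𝓝 (InfP φ c k)) := by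
      simpa using ((hlim'.const_div_atTop (φ (prefixList c k) : ℝ)).const_mul
        (DiamP φ c k)).const_add (InfP φ c k)
    refine tendsto_of_tendsto_of_tendsto_of_le_of_le' tendsto_const_nhds hup
      (Eventually.of_forall fun n => (hx n).1.le) ?_
    filter_upwards [eventually_ge_atTop n0] with n hn
    have hpre := hn0 n hn
    have h := valP_le_SupP hφ (hd n) (k + 1)
    rwa [SupP_succ φ _ _ (((hd n).tuple (k + 1)).two_le hφ (Nat.lt_succ_self k)),
      InfP_congr φ hpre, DiamP_congr φ hpre, prefixList_congr hpre] at h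
end

section
/- For each n ≥ 1 let d^{(n)} be a P-admissible sequence and set x_n = val_P(d^{(n)}). Then x_n → 0 as n → ∞ if and only if d^{(n)}_1 → ∞ as n → ∞. -/
open Filter Finset Topology

section

variable {φ : List ℕ → ℕ} {p : ℕ → ℕ}

theorem denomBase_pos (hφ : ∀ l, 0 < φ l) (hp : PAdmissibleSeq φ p) (n : ℕ) :
    0 < denomBase p n := by
  refine Finset.prod_pos fun j _ => ?_
  have h : (2 : ℝ) ≤ p j := by
    have h₁ := hp j
    have h₂ := hφ (prefixList p j)
    exact_mod_cast (by omega : 2 ≤ p j)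
  exact mul_pos (by linarith) (by linarith)

theorem numer_pos (hφ : ∀ l, 0 < φ l) (n : ℕ) : 0 < numer φ p n :=
  Finset.prod_pos fun _ _ => Nat.cast_pos.2 (hφ _)

theorem valP_term_nonneg (hφ : ∀ l, 0 < φ l) (hp : PAdmissibleSeq φ p) (n : ℕ) :
    0 ≤ numer φ p n / (denomBase p n * (p n : ℝ)) :=
  div_nonneg (numer_pos hφ n).le (mul_nonneg (denomBase_pos hφ hp n).le (Nat.cast_nonneg _))

theorem DiamP_nonneg (hφ : ∀ l, 0 < φ l) (hp : PAdmissibleSeq φ p) (n : ℕ) :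
    0 ≤ DiamP φ p n :=
  div_nonneg (Finset.prod_nonneg fun _ _ => Nat.cast_nonneg _) (denomBase_pos hφ hp n).le

/-- The upper endpoints of the nested fundamental intervals decrease. -/
theorem antitone_SupP (hφ : ∀ l, 0 < φ l) (hp : PAdmissibleSeq φ p) :
    Antitone (SupP φ p) := by
  refine antitone_nat_of_succ_le fun n => ?_
  have hr : (1 : ℝ) ≤ φ (prefixList p n) := by exact_mod_cast hφ (prefixList p n)
  have hpn : (φ (prefixList p n) : ℝ) + 1 ≤ p n := by exact_mod_cast hp n
  have hdiam : 0 ≤ DiamP φ p n := DiamP_nonneg hφ hp n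
  have hterm : numer φ p n / (denomBase p n * (p n : ℝ)) =
      DiamP φ p n * (φ (prefixList p n) / p n) := by
    rw [numer, Finset.prod_range_succ, DiamP, div_mul_div_comm]
  have hsucc : DiamP φ p (n + 1) =
      DiamP φ p n * (φ (prefixList p n) / (((p n : ℝ) - 1) * p n)) := by
    rw [DiamP, DiamP, denomBase, Finset.prod_range_succ, Finset.prod_range_succ,
      div_mul_div_comm, denomBase]
  have hfactor : (φ (prefixList p n) : ℝ) / p n +
      φ (prefixList p n) / (((p n : ℝ) - 1) * p n) ≤ 1 := by
    generalize (φ (prefixList p n) : ℝ) = r at hr hpn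
    generalize (p n : ℝ) = q at hpn
    have hq : 0 < q := by linarith
    have hq' : 0 < q - 1 := by linarith
    have : r / q + r / ((q - 1) * q) = r / (q - 1) := by
      field_simp
      ring
    rw [this, div_le_one hq']
    linarith
  have := mul_le_mul_of_nonneg_left hfactor hdiam
  rw [SupP, SupP, InfP, Finset.sum_range_succ, hterm, hsucc, ← InfP]
  linarith

theorem InfP_le (hφ : ∀ l, 0 < φ l) (hp : PAdmissibleSeq φ p) (n : ℕ) :
    InfP φ p n ≤ φ [] / ((p 0 : ℝ) - 1) := by
  have hr : (1 : ℝ) ≤ φ [] := by exact_mod_cast hφ []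
  have hp0 : (φ [] : ℝ) + 1 ≤ p 0 := by exact_mod_cast hp 0
  have hone : SupP φ p 1 = φ [] / ((p 0 : ℝ) - 1) := by
    have hq : (p 0 : ℝ) ≠ 0 := by linarith
    have hq' : (p 0 : ℝ) - 1 ≠ 0 := by linarith
    simp [SupP, InfP, DiamP, numer, denomBase, prefixList]
    field_simp
    ring
  calc InfP φ p n ≤ InfP φ p (n + 1) := by
        rw [InfP, InfP, Finset.sum_range_succ]
        linarith [valP_term_nonneg hφ hp n]
    _ ≤ SupP φ p (n + 1) := le_add_of_nonneg_right (DiamP_nonneg hφ hp (n + 1))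
    _ ≤ SupP φ p 1 := antitone_SupP hφ hp (by omega)
    _ = φ [] / ((p 0 : ℝ) - 1) := hone

theorem valP_le (hφ : ∀ l, 0 < φ l) (hp : PAdmissibleSeq φ p) :
    valP φ p ≤ φ [] / ((p 0 : ℝ) - 1) :=
  Real.tsum_le_of_sum_range_le (valP_term_nonneg hφ hp) (InfP_le hφ hp)

theorem le_valP (hφ : ∀ l, 0 < φ l) (hp : PAdmissibleSeq φ p) :
    φ [] / (p 0 : ℝ) ≤ valP φ p := by
  have hsum := summable_of_sum_range_le (valP_term_nonneg hφ hp) (InfP_le hφ hp)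
  have h := hsum.le_tsum 0 fun n _ => valP_term_nonneg hφ hp n
  simpa [valP, numer, denomBase, prefixList] using h

end

/-- `xₙ = val_P(d⁽ⁿ⁾) → 0` iff the first digits `d⁽ⁿ⁾₁ → ∞`. -/
theorem stmt4 (φ : List ℕ → ℕ) (hφ : ∀ l, 0 < φ l)
    (d : ℕ → (ℕ → ℕ)) (hd : ∀ n, PAdmissibleSeq φ (d n)) :
    Filter.Tendsto (fun n => valP φ (d n)) Filter.atTop (nhds 0) ↔
      Filter.Tendsto (fun n => d n 0) Filter.atTop Filter.atTop := by
  have hr : (0 : ℝ) < φ [] := by exact_mod_cast hφ []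
  have hlow : ∀ n, 0 < (φ [] : ℝ) / (d n 0 : ℝ) := fun n =>
    div_pos hr (Nat.cast_pos.2 (by have := hd n 0; omega))
  constructor
  · intro h
    have h₀ : Tendsto (fun n => (φ [] : ℝ) / (d n 0 : ℝ)) atTop (𝓝[>] 0) :=
      tendsto_nhdsWithin_iff.2 ⟨squeeze_zero (fun n => (hlow n).le)
        (fun n => le_valP hφ (hd n)) h, Eventually.of_forall hlow⟩
    have h₁ := h₀.inv_tendsto_nhdsGT_zero.const_mul_atTop hr
    refine tendsto_natCast_atTop_iff.1 (h₁.congr fun n => ?_)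
    rw [Pi.inv_apply, inv_div, mul_div_cancel₀ _ hr.ne']
  · intro h
    have h₁ : Tendsto (fun n => (d n 0 : ℝ) - 1) atTop atTop :=
      tendsto_atTop_add_const_right _ (-1) (tendsto_natCast_atTop_iff.2 h)
    exact squeeze_zero (fun n => (hlow n).le.trans (le_valP hφ (hd n)))
      (fun n => valP_le hφ (hd n)) (h₁.const_div_atTop _)
end
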